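/- Let n ≥ 1 and q ≥ 2 be integers, let P_1, …, P_q be subsets (events) of the set Π_n of all permutations of [n], and suppose that for each γ ∈ {1,…,q} the uniform measure of P_γ in Π_n is at least p_γ, where p_γ ∈ (0,1). Let p₀ = min{p_1,…,p_q} and let δ ∈ (0,1). Then there exists a non-empty finite multiset (list) L of permutations from Π_n of size at most ⌈2·(log₂ q)/(δ²·p₀)⌉ such that for every γ ∈ {1,…,q}, the number of entries of L (counted with multiplicity) belonging to P_γ is at least (1−δ)·p_γ·|L|; equivalently, a permutation drawn uniformly at random from L lies in P_γ with probability at least (1−δ)·p_γ. -/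

import Mathlib

open scoped Classical

lemma Real.exp_neg_le_one_sub_add_sq_half {x : ℝ} (hx : 0 ≤ x) :
    Real.exp (-x) ≤ 1 - x + x ^ 2 / 2 := by
  have h := Real.quadratic_le_exp_of_nonneg hx
  rw [Real.exp_neg, inv_le_iff_one_le_mul₀ (Real.exp_pos x)]
  have hpos : 0 ≤ 1 - x + x ^ 2 / 2 := by nlinarith [sq_nonneg (x - 1)]
  nlinarith [mul_le_mul_of_nonneg_left h hpos, sq_nonneg (x ^ 2)]

/-- The moment generating function bound for the indicator of a set `A` of density at least `p`. -/
lemma sum_exp_neg_indicator_le {α : Type*} [Fintype α] (A : Set α) {p δ : ℝ} (hδ : 0 ≤ δ)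
    (hA : p * Fintype.card α ≤ (Finset.univ.filter (· ∈ A)).card) :
    ∑ x : α, Real.exp (-(δ * if x ∈ A then 1 else 0)) ≤
      Fintype.card α * Real.exp (-(p * (1 - Real.exp (-δ)))) := by
  have hsum : ∑ x : α, Real.exp (-(δ * if x ∈ A then 1 else 0)) =
      Fintype.card α - (Finset.univ.filter (· ∈ A)).card * (1 - Real.exp (-δ)) := by
    have hterm (x : α) : Real.exp (-(δ * if x ∈ A then 1 else 0)) =
        1 - (if x ∈ A then 1 else 0) * (1 - Real.exp (-δ)) := by
      split_ifs <;> simp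
    simp_rw [hterm, Finset.sum_sub_distrib, ← Finset.sum_mul, Finset.sum_boole]
    simp
  have hexp : 0 ≤ 1 - Real.exp (-δ) := by
    have := Real.exp_le_one_iff.2 (neg_nonpos.2 hδ)
    linarith
  calc _ ≤ Fintype.card α * (1 - p * (1 - Real.exp (-δ))) := by
        rw [hsum]
        nlinarith [mul_le_mul_of_nonneg_right hA hexp]
    _ ≤ _ := by
        gcongr
        linarith [Real.add_one_le_exp (-(p * (1 - Real.exp (-δ))))]

/-- The exponential moment form of the lower-tail Chernoff bound for `m` independent uniform
samples. -/
lemma sum_exp_deviation_le {α : Type*} [Fintype α] (A : Set α) {p δ : ℝ} (hp : 0 ≤ p)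
    (hδ : 0 ≤ δ) (hA : p * Fintype.card α ≤ (Finset.univ.filter (· ∈ A)).card) (m : ℕ) :
    ∑ f : Fin m → α, Real.exp (δ * ((1 - δ) * p * m - (Finset.univ.filter (f · ∈ A)).card)) ≤
      (Fintype.card α : ℝ) ^ m * Real.exp (-(δ ^ 2 * p * m / 2)) := by
  have hterm (f : Fin m → α) :
      Real.exp (δ * ((1 - δ) * p * m - (Finset.univ.filter (f · ∈ A)).card)) =
        Real.exp (δ * ((1 - δ) * p * m)) *
          ∏ i, Real.exp (-(δ * if f i ∈ A then 1 else 0)) := by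
    rw [← Real.exp_sum, ← Real.exp_add, Finset.sum_neg_distrib, ← Finset.mul_sum,
      Finset.sum_boole]
    ring_nf
  simp_rw [hterm]
  rw [← Finset.mul_sum, ← Fintype.sum_pow (fun x => Real.exp (-(δ * if x ∈ A then 1 else 0)))]
  calc _ ≤ Real.exp (δ * ((1 - δ) * p * m)) *
        (Fintype.card α * Real.exp (-(p * (1 - Real.exp (-δ))))) ^ m := by
        gcongr
        exact sum_exp_neg_indicator_le A hδ hA
    _ = (Fintype.card α : ℝ) ^ m *
        Real.exp (δ * ((1 - δ) * p * m) - m * (p * (1 - Real.exp (-δ)))) := by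
        rw [mul_pow, ← Real.exp_nat_mul, mul_left_comm, ← Real.exp_add]
        ring_nf
    _ ≤ _ := by
        gcongr
        have h := Real.exp_neg_le_one_sub_add_sq_half hδ
        have hpm : 0 ≤ p * m := by positivity
        nlinarith [mul_le_mul_of_nonneg_left h hpm]

/-- If `m` is large enough for the union bound over the Chernoff estimates, some `m` samples
simultaneously hit every event nearly as often as expected. -/
lemma exists_sample_of_union_bound {α ι : Type*} [Fintype α] [Nonempty α] [Fintype ι]
    (A : ι → Set α) {p : ι → ℝ} {p₀ δ : ℝ} (hp₀ : ∀ γ, p₀ ≤ p γ) (hp : ∀ γ, 0 ≤ p γ) (hδ : 0 < δ)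
    (hA : ∀ γ, p γ * Fintype.card α ≤ (Finset.univ.filter (· ∈ A γ)).card) (m : ℕ)
    (hm : Fintype.card ι * Real.exp (-(δ ^ 2 * p₀ * m / 2)) < 1) :
    ∃ f : Fin m → α, ∀ γ,
      (1 - δ) * p γ * m ≤ (Finset.univ.filter (f · ∈ A γ)).card := by
  by_contra! hbad
  have hlow (f : Fin m → α) : 1 ≤ ∑ γ,
      Real.exp (δ * ((1 - δ) * p γ * m - (Finset.univ.filter (f · ∈ A γ)).card)) := by
    obtain ⟨γ, hγ⟩ := hbad f
    exact (Real.one_le_exp (mul_nonneg hδ.le (sub_nonneg.2 hγ.le))).trans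
      (Finset.single_le_sum
        (f := fun γ => Real.exp (δ * ((1 - δ) * p γ * m - (Finset.univ.filter (f · ∈ A γ)).card)))
        (fun _ _ => (Real.exp_pos _).le) (Finset.mem_univ γ))
  have hcard : (0 : ℝ) < (Fintype.card α : ℝ) ^ m := by
    have : 0 < Fintype.card α := Fintype.card_pos
    positivity
  have hupp : (Fintype.card α : ℝ) ^ m ≤
      (Fintype.card α : ℝ) ^ m * (Fintype.card ι * Real.exp (-(δ ^ 2 * p₀ * m / 2))) := by
    calc (Fintype.card α : ℝ) ^ m = ∑ _f : Fin m → α, (1 : ℝ) := by simp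
      _ ≤ ∑ f : Fin m → α, ∑ γ, Real.exp
          (δ * ((1 - δ) * p γ * m - (Finset.univ.filter (f · ∈ A γ)).card)) :=
          Finset.sum_le_sum fun f _ => hlow f
      _ = ∑ γ, ∑ f : Fin m → α, Real.exp
          (δ * ((1 - δ) * p γ * m - (Finset.univ.filter (f · ∈ A γ)).card)) := Finset.sum_comm
      _ ≤ ∑ _γ : ι, (Fintype.card α : ℝ) ^ m * Real.exp (-(δ ^ 2 * p₀ * m / 2)) := by
          refine Finset.sum_le_sum fun γ _ =>
            (sum_exp_deviation_le (A γ) (hp γ) hδ.le (hA γ) m).trans ?_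
          gcongr
          exact hp₀ γ
      _ = _ := by
          rw [Finset.sum_const, Finset.card_univ, nsmul_eq_mul]
          ring
  nlinarith

/-- **Existence of a small multiset of permutations nearly preserving positive
events (probabilistic/Chernoff argument).**
If events `P_1, …, P_q ⊆ Π_n` have uniform measures at least `p_1, …, p_q`
respectively, `p₀ = min_γ p_γ`, and `δ ∈ (0,1)`, then there is a non-empty
multiset `L` of permutations of size at most `⌈2·log₂ q/(δ²·p₀)⌉` such that,
for each `γ`, the fraction of entries of `L` lying in `P_γ` is at least
`(1−δ)·p_γ`. -/
theorem exists_small_multiset_preserving_events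
    (n q : ℕ) (hn : 1 ≤ n) (hq : 2 ≤ q)
    (P : Fin q → Set (Equiv.Perm (Fin n))) (p : Fin q → ℝ)
    (hp : ∀ γ, p γ ∈ Set.Ioo (0 : ℝ) 1)
    (hmeas : ∀ γ, p γ ≤
      ((Finset.univ.filter (fun π : Equiv.Perm (Fin n) => π ∈ P γ)).card : ℝ) /
        (Nat.factorial n))
    (p₀ : ℝ) (hp₀ : IsLeast (Set.range p) p₀)
    (δ : ℝ) (hδ : δ ∈ Set.Ioo (0 : ℝ) 1) :
    ∃ L : Multiset (Equiv.Perm (Fin n)), L ≠ 0 ∧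
      Multiset.card L ≤ ⌈2 * Real.logb 2 q / (δ ^ 2 * p₀)⌉₊ ∧
      ∀ γ, (1 - δ) * p γ * (Multiset.card L) ≤
        ((L.countP (fun π => π ∈ P γ)) : ℝ) := by
  obtain ⟨hδ0, -⟩ := hδ
  obtain ⟨⟨γ₀, rfl⟩, hmin⟩ := hp₀
  have hp₀pos := (hp γ₀).1
  have hq1 : (1 : ℝ) < q := by exact_mod_cast hq
  have hlogq : 0 < Real.log q := Real.log_pos hq1
  have hlog : Real.log q < Real.logb 2 q := by
    rw [Real.logb, lt_div_iff₀ (Real.log_pos one_lt_two)]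
    nlinarith [Real.log_two_lt_d9]
  have hden : 0 < δ ^ 2 * p γ₀ := by positivity
  set m := ⌈2 * Real.logb 2 q / (δ ^ 2 * p γ₀)⌉₊ with hm
  have hm0 : 0 < m := Nat.ceil_pos.2 (div_pos (by linarith) hden)
  have hceil : 2 * Real.logb 2 q ≤ m * (δ ^ 2 * p γ₀) :=
    (div_le_iff₀ hden).1 (Nat.le_ceil _)
  have hunion : Fintype.card (Fin q) * Real.exp (-(δ ^ 2 * p γ₀ * m / 2)) < 1 := by
    rw [Fintype.card_fin]
    nth_rewrite 1 [← Real.exp_log (zero_lt_one.trans hq1)]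
    rw [← Real.exp_add, Real.exp_lt_one_iff]
    linarith
  obtain ⟨f, hf⟩ := exists_sample_of_union_bound P (fun γ => hmin ⟨γ, rfl⟩)
    (fun γ => (hp γ).1.le) hδ0 (fun γ => by
      rw [Fintype.card_perm, Fintype.card_fin]
      exact (le_div_iff₀ (by positivity)).1 (hmeas γ)) m hunion
  have hcard : Multiset.card (Finset.univ.val.map f) = m := by simp
  refine ⟨Finset.univ.val.map f, ?_, hcard.le, fun γ => ?_⟩
  · rw [← Multiset.card_pos, hcard]
    exact hm0
  · rw [hcard, Multiset.countP_map]
    exact hf γ
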